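/- For every rooted tree S on a finite set I and all rooted trees T₁, …, T_n on pairwise disjoint finite label sets, each disjoint from I, the symmetric brace product associated to the fall product satisfies Br(S; T₁, …, T_n) = ∑_{φ : {1,…,n} → I} S_φ, where S_φ denotes the rooted tree obtained from S by grafting each T_i as an additional subtree at the vertex labeled φ(i). In particular, Br(S; T₁, …, T_n) is symmetric in T₁, …, T_n. -/

import Mathlib

/-- A raw rooted tree on a finite label set: vertices are labels (`verts`),
with a distinguished `root` and a `parent` function. -/
structure RTree where
  verts : Finset ℕ
  root : ℕ
  parent : ℕ → ℕ

/-- `S` is a genuine rooted tree on the label set `S.verts`. -/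
def IsRTree (S : RTree) : Prop :=
  S.root ∈ S.verts ∧
  (∀ v ∈ S.verts, S.parent v ∈ S.verts) ∧
  S.parent S.root = S.root ∧
  (∀ v ∈ S.verts, ∃ k : ℕ, S.parent^[k] v = S.root) ∧
  (∀ v, v ∉ S.verts → S.parent v = v)

/-- `graft S v T` grafts `T` as an additional subtree at the vertex labeled `v` of `S`. -/
def graft (S : RTree) (v : ℕ) (T : RTree) : RTree where
  verts := S.verts ∪ T.verts
  root := S.root
  parent := fun w =>
    if w ∈ T.verts then (if w = T.root then v else T.parent w) else S.parent w

/-- The fall product: `S ⋆ T = ∑_{v ∈ S.verts} S ∪_v T`. -/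
noncomputable def fallT (S T : RTree) : RTree →₀ ℚ :=
  ∑ v ∈ S.verts, Finsupp.single (graft S v T) 1

/-- Bilinear extension of the fall product. -/
noncomputable def fall (a b : RTree →₀ ℚ) : RTree →₀ ℚ :=
  ∑ S ∈ a.support, ∑ T ∈ b.support, (a S * b T) • fallT S T

/-- Symmetric brace products, with the list of arguments in *reverse* order:
`brAux s [Tₘ₊₁, Tₘ, …, T₁]` is `Br(s; T₁, …, Tₘ₊₁)`, defined by the recursion
`Br(S; T₁,…,T_{m+1}) = Br(S; T₁,…,T_m) ⋆ T_{m+1} − ∑ᵢ Br(S; T₁,…,Tᵢ⋆T_{m+1},…,T_m)`. -/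
noncomputable def brAux (s : RTree →₀ ℚ) : List (RTree →₀ ℚ) → (RTree →₀ ℚ)
  | [] => s
  | t :: L => fall (brAux s L) t
      - ∑ i : Fin L.length, brAux s (L.set i (fall (L.get i) t))
  termination_by L => L.length
  decreasing_by
  · simp
  · simp [List.length_set]

/-- The symmetric brace product `Br(s; T₁, …, Tₙ)` (arguments in natural order). -/
noncomputable def Br (s : RTree →₀ ℚ) (ts : List (RTree →₀ ℚ)) : RTree →₀ ℚ :=
  brAux s ts.reverse

/-- `multigraft S T φ` is the tree `S_φ` obtained from `S` by grafting each `T i`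
as an additional subtree at the vertex labeled `φ i`. -/
def multigraft (S : RTree) {n : ℕ} (T : Fin n → RTree) (φ : Fin n → ℕ) : RTree :=
  (List.finRange n).foldl (fun s i => graft s (φ i) (T i)) S

theorem fall_eq_sum (a b : RTree →₀ ℚ) :
    fall a b = a.sum fun S c => b.sum fun T d => (c * d) • fallT S T :=
  rfl

theorem fall_add_left (a a' b : RTree →₀ ℚ) : fall (a + a') b = fall a b + fall a' b := by
  simp only [fall_eq_sum]
  refine Finsupp.sum_add_index' (by simp) fun S c c' => ?_
  simp [add_mul, add_smul]

theorem fall_add_right (a b b' : RTree →₀ ℚ) : fall a (b + b') = fall a b + fall a b' := by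
  simp only [fall_eq_sum]
  rw [← Finsupp.sum_add]
  refine Finsupp.sum_congr fun S _ => Finsupp.sum_add_index' (by simp) ?_
  simp [mul_add, add_smul]

theorem fall_single_single (S T : RTree) :
    fall (Finsupp.single S 1) (Finsupp.single T 1) = fallT S T := by
  simp [fall_eq_sum]

theorem brAux_cons (s t : RTree →₀ ℚ) (L : List (RTree →₀ ℚ)) :
    brAux s (t :: L) = fall (brAux s L) t
      - ∑ j ∈ Finset.range L.length, brAux s (L.modify j (fall · t)) := by
  rw [brAux, Finset.sum_range]
  congr 1
  refine Finset.sum_congr rfl fun i _ => ?_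
  rw [List.modify_eq_set_get _ i.2]

/-- Brace products are additive in each argument after the first. -/
theorem brAux_set_add (s a b : RTree →₀ ℚ) (L : List (RTree →₀ ℚ)) (i : ℕ) (hi : i < L.length) :
    brAux s (L.set i (a + b)) = brAux s (L.set i a) + brAux s (L.set i b) := by
  induction hn : L.length generalizing L i a b with
  | zero => omega
  | succ n ih =>
    obtain _ | ⟨t, L⟩ := L
    · simp at hi
    replace hn : L.length = n := by simpa using hn
    cases i with
    | zero =>
      simp only [List.set_cons_zero, brAux_cons, fall_add_right]
      have h : ∀ j ∈ Finset.range L.length,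
          brAux s (L.modify j fun x => fall x a + fall x b) =
            brAux s (L.modify j (fall · a)) + brAux s (L.modify j (fall · b)) := by
        intro j hj
        have hj := Finset.mem_range.1 hj
        simp only [List.modify_eq_set_get _ hj]
        exact ih _ _ _ _ hj hn
      rw [Finset.sum_congr rfl h, Finset.sum_add_distrib]
      abel
    | succ i =>
      replace hi : i < L.length := by simpa using hi
      simp only [List.set_cons_succ, brAux_cons, List.length_set, ih a b L i hi hn, fall_add_left]
      have h : ∀ j ∈ Finset.range L.length,
          brAux s ((L.set i (a + b)).modify j (fall · t)) =
            brAux s ((L.set i a).modify j (fall · t)) +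
              brAux s ((L.set i b).modify j (fall · t)) := by
        intro j hj
        have hj := Finset.mem_range.1 hj
        have hc (x : RTree →₀ ℚ) : (L.set i x).modify j (fall · t) =
            if i = j then L.set i (fall x t) else (L.modify j (fall · t)).set i x := by
          apply List.ext_getElem?
          intro k
          split_ifs <;> grind
        simp only [hc]
        split_ifs
        · rw [fall_add_left]
          exact ih _ _ _ _ hi hn
        · exact ih _ _ _ _ (by simpa using hi) (by simpa using hn)
      rw [Finset.sum_congr rfl h, Finset.sum_add_distrib]
      abel

theorem brAux_set_sum {ι : Type*} (s : RTree →₀ ℚ) (L : List (RTree →₀ ℚ)) (i : ℕ)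
    (hi : i < L.length) (X : Finset ι) (f : ι → RTree →₀ ℚ) :
    brAux s (L.set i (∑ v ∈ X, f v)) = ∑ v ∈ X, brAux s (L.set i (f v)) :=
  map_sum (AddMonoidHom.mk' (fun a => brAux s (L.set i a))
    fun a b => brAux_set_add s a b L i hi) f X

theorem graft_graft_comm (U : RTree) (u v : ℕ) {T T' : RTree} (h : Disjoint T.verts T'.verts) :
    graft (graft U u T) v T' = graft (graft U v T') u T := by
  have h := Finset.disjoint_left.1 h
  simp only [graft, RTree.mk.injEq, true_and]
  exact ⟨Finset.union_right_comm _ _ _, by grind⟩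

theorem graft_graft_assoc (U : RTree) (u v : ℕ) {T T' : RTree} (hT : T.root ∉ T'.verts) :
    graft (graft U u T) v T' = graft U u (graft T v T') := by
  simp only [graft, RTree.mk.injEq, true_and]
  exact ⟨Finset.union_assoc _ _ _, by grind⟩

/-- The linear extension of the map grafting `T` at the vertex labeled `v`. -/
noncomputable def graftAt (v : ℕ) (T : RTree) : (RTree →₀ ℚ) →ₗ[ℚ] (RTree →₀ ℚ) :=
  Finsupp.lmapDomain ℚ ℚ (graft · v T)

theorem graftAt_single (v : ℕ) (T U : RTree) (c : ℚ) :
    graftAt v T (Finsupp.single U c) = Finsupp.single (graft U v T) c := by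
  simp [graftAt]

theorem graftAt_comm (u v : ℕ) {T T' : RTree} (h : Disjoint T.verts T'.verts)
    (a : RTree →₀ ℚ) : graftAt v T' (graftAt u T a) = graftAt u T (graftAt v T' a) := by
  induction a using Finsupp.induction_linear with
  | zero => simp
  | add f g hf hg => simp [hf, hg]
  | single U c => simp [graftAt_single, graft_graft_comm U u v h]

theorem graftAt_assoc (u v : ℕ) {T T' : RTree} (hT : T.root ∉ T'.verts)
    (a : RTree →₀ ℚ) : graftAt v T' (graftAt u T a) = graftAt u (graft T v T') a := by
  induction a using Finsupp.induction_linear with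
  | zero => simp
  | add f g hf hg => simp [hf, hg]
  | single U c => simp [graftAt_single, graft_graft_assoc U u v hT]

/-- The sum of all simultaneous grafts of the trees in the list at vertices of `S`. -/
noncomputable def graftSum (S : RTree) (L : List RTree) : RTree →₀ ℚ :=
  L.foldr (fun T a => ∑ v ∈ S.verts, graftAt v T a) (Finsupp.single S 1)

theorem graftSum_cons (S T : RTree) (L : List RTree) :
    graftSum S (T :: L) = ∑ v ∈ S.verts, graftAt v T (graftSum S L) :=
  rfl

theorem graftSum_perm (S : RTree) {L L' : List RTree} (hp : L.Perm L')
    (hL : L.Pairwise fun T T' => Disjoint T.verts T'.verts) :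
    graftSum S L = graftSum S L' := by
  refine hp.foldr_eq' (fun T hT T' hT' a => ?_) _
  by_cases h : T = T'
  · rw [h]
  have hd : Disjoint T.verts T'.verts :=
    have : Std.Symm fun T T' : RTree => Disjoint T.verts T'.verts := ⟨fun _ _ h => h.symm⟩
    hL.forall hT hT' h
  simp only [map_sum]
  rw [Finset.sum_comm]
  simp only [graftAt_comm _ _ hd]

/-- The labels of the trees obtained by grafting the trees in the list onto `S`. -/
def graftVerts (S : RTree) (L : List RTree) : Finset ℕ :=
  L.foldr (fun T X => X ∪ T.verts) S.verts

theorem graftVerts_cons (S T : RTree) (L : List RTree) :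
    graftVerts S (T :: L) = graftVerts S L ∪ T.verts :=
  rfl

theorem mem_graftVerts {S : RTree} {L : List RTree} {v : ℕ} :
    v ∈ graftVerts S L ↔ v ∈ S.verts ∨ ∃ T ∈ L, v ∈ T.verts := by
  induction L with
  | nil => simp [graftVerts]
  | cons T L ih =>
    simp [graftVerts_cons, ih, or_left_comm, or_comm]

theorem fall_single_right {a : RTree →₀ ℚ} {X : Finset ℕ} (t : RTree)
    (ha : ∀ U ∈ a.support, U.verts = X) :
    fall a (Finsupp.single t 1) = ∑ v ∈ X, graftAt v t a := by
  have h (U : RTree) (c : ℚ) : ((Finsupp.single t (1 : ℚ)).sum fun T d => (c * d) • fallT U T) =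
      c • fallT U t := by
    rw [Finsupp.sum_single_index (by simp), mul_one]
  simp only [fall_eq_sum, h, graftAt, Finsupp.lmapDomain_apply, Finsupp.mapDomain]
  simp only [Finsupp.sum]
  rw [Finset.sum_comm (s := X)]
  refine Finset.sum_congr rfl fun U hU => ?_
  rw [fallT, ha U hU, Finset.smul_sum]
  simp only [Finsupp.smul_single, smul_eq_mul, mul_one]

theorem verts_of_mem_support_graftSum {S U : RTree} {L : List RTree}
    (hU : U ∈ (graftSum S L).support) : U.verts = graftVerts S L := by
  classical
  induction L generalizing U with
  | nil =>
    have := Finsupp.support_single_subset hU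
    simp_all [graftVerts]
  | cons T L ih =>
    rw [graftSum_cons] at hU
    obtain ⟨v, -, hv⟩ := Finset.mem_biUnion.1 (Finsupp.support_finsetSum hU)
    obtain ⟨W, hW, rfl⟩ := Finset.mem_image.1 (Finsupp.mapDomain_support hv)
    exact congrArg (· ∪ T.verts) (ih hW)

theorem fall_graftSum (S t : RTree) (L : List RTree) :
    fall (graftSum S L) (Finsupp.single t 1) =
      ∑ v ∈ graftVerts S L, graftAt v t (graftSum S L) :=
  fall_single_right t fun _ => verts_of_mem_support_graftSum

theorem sum_graftVerts {M : Type*} [AddCommMonoid M] {S : RTree} {L : List RTree}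
    (h : (S :: L).Pairwise fun T T' => Disjoint T.verts T'.verts) (f : ℕ → M) :
    ∑ v ∈ graftVerts S L, f v =
      ∑ v ∈ S.verts, f v + ∑ j : Fin L.length, ∑ v ∈ L[j].verts, f v := by
  induction L with
  | nil => simp [graftVerts]
  | cons T L ih =>
    have hd : Disjoint (graftVerts S L) T.verts := by
      rw [Finset.disjoint_left]
      intro v hv hvT
      simp only [List.pairwise_cons, List.mem_cons, forall_eq_or_imp, Finset.disjoint_left] at h
      rcases mem_graftVerts.1 hv with hv | ⟨T', hT', hv⟩
      · exact h.1.1 hv hvT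
      · exact h.2.1 T' hT' hvT hv
    rw [graftVerts_cons, Finset.sum_union hd, ih (h.sublist (by simp))]
    simp only [List.length_cons, Fin.sum_univ_succ]
    simp [add_comm, add_left_comm]

theorem graftAt_graftSum {S t : RTree} {L : List RTree} {j v : ℕ} (hj : j < L.length)
    (hr : L[j].root ∉ t.verts) (hd : ∀ T ∈ L, Disjoint T.verts t.verts) :
    graftAt v t (graftSum S L) = graftSum S (L.set j (graft L[j] v t)) := by
  induction L generalizing j with
  | nil => simp at hj
  | cons T L ih =>
    cases j with
    | zero =>
      simp only [List.getElem_cons_zero] at hr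
      simp [graftSum_cons, graftAt_assoc _ _ hr]
    | succ j =>
      simp only [List.getElem_cons_succ] at hr
      simp [graftSum_cons, graftAt_comm _ _ (hd T (by simp)),
        ih (by simpa using hj) hr (fun T hT => hd T (by simp [hT]))]

theorem brAux_eq_graftSum {S : RTree} {L : List RTree}
    (h : (S :: L).Pairwise fun T T' => Disjoint T.verts T'.verts)
    (hr : ∀ T ∈ L, T.root ∈ T.verts) :
    brAux (Finsupp.single S 1) (L.map (Finsupp.single · 1)) = graftSum S L := by
  induction hn : L.length generalizing L with
  | zero =>
    obtain rfl := List.length_eq_zero_iff.1 hn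
    simp [brAux, graftSum]
  | succ n ih =>
    obtain _ | ⟨t, L⟩ := L
    · simp at hn
    replace hn : L.length = n := by simpa using hn
    have hL : (S :: L).Pairwise fun T T' => Disjoint T.verts T'.verts := h.sublist (by simp)
    have hrL : ∀ T ∈ L, T.root ∈ T.verts := fun T hT => hr T (by simp [hT])
    have ht : ∀ T ∈ L, Disjoint T.verts t.verts := fun T hT =>
      ((List.pairwise_cons.1 (List.pairwise_cons.1 h).2).1 T hT).symm
    rw [List.map_cons, brAux_cons, ih hL hrL hn, fall_graftSum, sum_graftVerts hL, graftSum_cons,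
      sub_eq_iff_eq_add, add_right_inj, List.length_map, Finset.sum_range]
    refine Finset.sum_congr rfl fun j _ => ?_
    rw [List.modify_eq_set_get _ (by simp), List.get_eq_getElem, List.getElem_map,
      fall_single_single, fallT, brAux_set_sum _ _ _ (by simp)]
    refine Finset.sum_congr rfl fun v hv => ?_
    have hj := ht _ (List.getElem_mem j.2)
    rw [← List.map_set, graftAt_graftSum j.2
      (Finset.disjoint_left.1 hj (hrL _ (List.getElem_mem j.2))) ht]
    symm
    refine ih ?_ ?_ (by simpa using hn)
    · have hi : ∀ T ∈ S :: L, Disjoint T.verts t.verts := by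
        simpa using ⟨(List.pairwise_cons.1 h).1 t (by simp), ht⟩
      rw [← List.set_cons_succ]
      rw [List.pairwise_iff_getElem] at hL ⊢
      intro a b ha hb hab
      simp only [List.length_set] at ha hb
      have hda := hi _ (List.getElem_mem ha)
      have hdb := hi _ (List.getElem_mem hb)
      have hdis := hL a b ha hb hab
      rw [List.getElem_set, List.getElem_set]
      split_ifs with h₁ h₂ h₂
      · omega
      · subst h₁
        exact Finset.disjoint_union_left.2 ⟨hdis, hdb.symm⟩
      · subst h₂
        exact Finset.disjoint_union_right.2 ⟨hdis, hda⟩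
      · exact hdis
    · intro T hT
      rcases List.mem_or_eq_of_mem_set hT with hT | rfl
      · exact hrL T hT
      · exact Finset.mem_union_left _ (hrL _ (List.getElem_mem j.2))

theorem sum_multigraft_eq_graftSum (S : RTree) {n : ℕ} (T : Fin n → RTree) :
    ∑ φ ∈ Fintype.piFinset (fun _ : Fin n => S.verts), Finsupp.single (multigraft S T φ) (1 : ℚ)
      = graftSum S (List.ofFn T).reverse := by
  induction n with
  | zero => simp [multigraft, graftSum]
  | succ n ih =>
    have hm (v : ℕ) (φ : Fin n → ℕ) :
        multigraft S T (Fin.snoc φ v) =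
          graft (multigraft S (fun i => T i.castSucc) φ) v (T (Fin.last n)) := by
      simp [multigraft, List.finRange_succ_last, List.foldl_map]
    have hs : Fintype.piFinset (fun _ : Fin (n + 1) => S.verts) =
        (S.verts ×ˢ Fintype.piFinset fun _ : Fin n => S.verts).map
          (Fin.snocEquiv fun _ => ℕ).toEmbedding := by
      simpa [Fin.init_def] using Finset.filter_piFinset_eq_map_snocEquiv
        (fun _ : Fin (n + 1) => S.verts) (fun _ => True)
    rw [List.ofFn_succ', List.concat_eq_append, List.reverse_append, List.reverse_singleton,
      List.singleton_append, graftSum_cons, ← ih, hs, Finset.sum_map, Finset.sum_product]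
    simp [Fin.snocEquiv, hm, graftAt_single]

/-- The symmetric brace product of rooted trees is the sum over all functions
`φ : {1,…,n} → S.verts` of the simultaneous grafts `S_φ`; in particular it is
symmetric in its arguments `T₁, …, Tₙ`. -/
theorem brace_eq_sum_of_grafts (S : RTree) (hS : IsRTree S) {n : ℕ} (T : Fin n → RTree)
    (hT : ∀ i, IsRTree (T i))
    (hd : ∀ i, Disjoint S.verts (T i).verts)
    (hd' : ∀ i j, i ≠ j → Disjoint (T i).verts (T j).verts) :
    Br (Finsupp.single S 1) (List.ofFn fun i => Finsupp.single (T i) (1 : ℚ))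
        = ∑ φ ∈ Fintype.piFinset (fun _ : Fin n => S.verts),
            Finsupp.single (multigraft S T φ) (1 : ℚ) ∧
    ∀ σ : Equiv.Perm (Fin n),
      Br (Finsupp.single S 1) (List.ofFn fun i => Finsupp.single (T (σ i)) (1 : ℚ))
        = Br (Finsupp.single S 1) (List.ofFn fun i => Finsupp.single (T i) (1 : ℚ)) := by
  have hdis (σ : Equiv.Perm (Fin n)) : (List.ofFn (T ∘ σ)).reverse.Pairwise
      fun T T' => Disjoint T.verts T'.verts :=
    List.pairwise_reverse.2 <| List.pairwise_ofFn.2 fun i j hij =>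
      hd' _ _ (σ.injective.ne hij.ne')
  have hBr (σ : Equiv.Perm (Fin n)) :
      Br (Finsupp.single S 1) (List.ofFn fun i => Finsupp.single (T (σ i)) (1 : ℚ)) =
        graftSum S (List.ofFn (T ∘ σ)).reverse := by
    rw [← brAux_eq_graftSum, Br, List.map_reverse, List.map_ofFn]
    · rfl
    · exact List.pairwise_cons.2 ⟨by simpa using fun i => hd (σ i), hdis σ⟩
    · simpa using fun i => (hT (σ i)).1
  refine ⟨(hBr 1).trans (sum_multigraft_eq_graftSum S T).symm, fun σ => ?_⟩
  refine (hBr σ).trans (.trans (graftSum_perm S ?_ (hdis σ)) (hBr 1).symm)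
  exact (List.reverse_perm _).trans ((σ.ofFn_comp_perm T).trans (List.reverse_perm _).symm)
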